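/- arXiv:1712.03602 — 2 statements merged into one kernel-verified Lean document; each statement's English description precedes it below -/
import Mathlib

section
/- ∫₀^∞ t·tanh(t/2)·log(tanh(t/4)) dt = −π² log 2. -/
open MeasureTheory Real Set

open Filter Topology

theorem lintegral_Ioo_ofReal_of_hasDerivAt {a b : ℝ} (hab : a ≤ b) {F f : ℝ → ℝ}
    (hF : ∀ x ∈ Icc a b, HasDerivAt F (f x) x) (hf : ∀ x ∈ Ioo a b, 0 ≤ f x) :
    ∫⁻ x in Ioo a b, ENNReal.ofReal (f x) = ENNReal.ofReal (F b - F a) := by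
  have hc : ContinuousOn F (Icc a b) := fun x hx => (hF x hx).continuousAt.continuousWithinAt
  have hd : ∀ x ∈ Ioo a b, HasDerivAt F (f x) x := fun x hx => hF x (Ioo_subset_Icc_self hx)
  have hi : IntegrableOn f (Ioc a b) := intervalIntegral.integrableOn_deriv_of_nonneg hc hd hf
  rw [← intervalIntegral.integral_eq_sub_of_hasDerivAt_of_le hab hc hd
      ((intervalIntegrable_iff_integrableOn_Ioc_of_le hab).2 hi),
    intervalIntegral.integral_of_le hab, integral_Ioc_eq_integral_Ioo]
  refine (ofReal_integral_eq_lintegral_ofReal (hi.mono_set Ioo_subset_Ioc_self) ?_).symm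
  exact (ae_restrict_iff' measurableSet_Ioo).2 (ae_of_all _ hf)

theorem lintegral_Ioi_ofReal_of_hasDerivAt {a l : ℝ} {F f : ℝ → ℝ}
    (hF : ∀ x ∈ Ici a, HasDerivAt F (f x) x) (hf : ∀ x ∈ Ioi a, 0 ≤ f x)
    (hl : Tendsto F atTop (𝓝 l)) :
    ∫⁻ x in Ioi a, ENNReal.ofReal (f x) = ENNReal.ofReal (l - F a) := by
  rw [← integral_Ioi_of_hasDerivAt_of_nonneg' hF hf hl]
  refine (ofReal_integral_eq_lintegral_ofReal (integrableOn_Ioi_deriv_of_nonneg' hF hf hl) ?_).symm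
  exact (ae_restrict_iff' measurableSet_Ioi).2 (ae_of_all _ hf)

theorem lintegral_lintegral_lt_swap (T : Set ℝ) {F : ℝ → ℝ → ENNReal}
    (hF : Measurable (Function.uncurry F)) :
    ∫⁻ x in T, ∫⁻ y in Iio x ∩ T, F x y = ∫⁻ y in T, ∫⁻ x in Ioi y ∩ T, F x y := by
  have hm : MeasurableSet {p : ℝ × ℝ | p.2 < p.1} := measurableSet_lt measurable_snd measurable_fst
  have hG := (hF.indicator hm).aemeasurable (μ := (volume.restrict T).prod (volume.restrict T))
  have key := lintegral_lintegral_swap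
    (f := fun x y => indicator {p : ℝ × ℝ | p.2 < p.1} (Function.uncurry F) (x, y)) hG
  refine Eq.trans (lintegral_congr fun x => ?_) (key.trans (lintegral_congr fun y => ?_))
  · rw [← Measure.restrict_restrict measurableSet_Iio, ← lintegral_indicator measurableSet_Iio]
    rfl
  · rw [← Measure.restrict_restrict measurableSet_Ioi, ← lintegral_indicator measurableSet_Ioi]
    rfl

theorem tendsto_sinh_atTop : Tendsto sinh atTop atTop :=
  tendsto_atTop_mono' _ ((eventually_ge_atTop 0).mono fun _ h => self_le_sinh_iff.2 h) tendsto_id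

theorem tendsto_cosh_atTop : Tendsto cosh atTop atTop :=
  tendsto_atTop_mono (fun x => (sinh_lt_cosh x).le) tendsto_sinh_atTop

theorem hasDerivAt_log_add_div_sub {c C : ℝ} (hc : 0 ≤ c) (h : c < C) :
    HasDerivAt (fun x => log ((C + x) / (C - x)) / 2) (C / (C ^ 2 - c ^ 2)) c := by
  have h1 : C + c ≠ 0 := by linarith
  have h2 : C - c ≠ 0 := by linarith
  have h3 : C ^ 2 - c ^ 2 ≠ 0 := by
    rw [show C ^ 2 - c ^ 2 = (C + c) * (C - c) by ring]; positivity
  have := ((((hasDerivAt_id' c).const_add C).fun_div ((hasDerivAt_id' c).const_sub C) h2).log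
    (div_ne_zero h1 h2)).div_const 2
  refine this.congr_deriv ?_
  field_simp
  ring

theorem hasDerivAt_log_add_div_sub_right {c C : ℝ} (hc : 0 ≤ c) (h : c < C) :
    HasDerivAt (fun x => log ((x + c) / (x - c)) / 2) (-(c / (C ^ 2 - c ^ 2))) C := by
  have h1 : C + c ≠ 0 := by linarith
  have h2 : C - c ≠ 0 := by linarith
  have h3 : C ^ 2 - c ^ 2 ≠ 0 := by
    rw [show C ^ 2 - c ^ 2 = (C + c) * (C - c) by ring]; positivity
  have := ((((hasDerivAt_id' C).add_const c).fun_div ((hasDerivAt_id' C).sub_const c) h2).log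
    (div_ne_zero h1 h2)).div_const 2
  refine this.congr_deriv ?_
  field_simp
  ring

theorem lintegral_div_sq_sub_sq {c C : ℝ} (hc : 0 ≤ c) (h : c < C) :
    ∫⁻ b in Ioo 0 c, ENNReal.ofReal (C / (C ^ 2 - b ^ 2)) =
      ENNReal.ofReal (log ((C + c) / (C - c)) / 2) := by
  rw [lintegral_Ioo_ofReal_of_hasDerivAt hc
    (fun x hx => hasDerivAt_log_add_div_sub hx.1 (hx.2.trans_lt h))]
  · simp [div_self (show C ≠ 0 by linarith)]
  · intro x hx
    have : x ^ 2 ≤ C ^ 2 := pow_le_pow_left₀ hx.1.le (by linarith [hx.2]) 2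
    exact div_nonneg (by linarith) (by linarith)

theorem sq_lt_cosh_sq {c : ℝ} (hc : 0 ≤ c) (h : c < 1) (s : ℝ) : c ^ 2 < cosh s ^ 2 :=
  pow_lt_pow_left₀ (h.trans_le (one_le_cosh s)) hc two_ne_zero

theorem lintegral_sinh_div_cosh_sq_sub_sq {c r : ℝ} (hc : 0 < c) (h : c < 1) (hr : 0 < r) :
    ∫⁻ s in Ioi r, ENNReal.ofReal (sinh s / (cosh s ^ 2 - c ^ 2)) =
      ENNReal.ofReal (c⁻¹ * (log ((cosh r + c) / (cosh r - c)) / 2)) := by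
  have hl : Tendsto (fun s => -c⁻¹ * (log ((cosh s + c) / (cosh s - c)) / 2)) atTop (𝓝 0) := by
    have h1 : Tendsto (fun x : ℝ => 1 + 2 * c / (x - c)) atTop (𝓝 (1 + 0)) :=
      ((tendsto_atTop_add_const_right atTop (-c) tendsto_id).const_div_atTop (2 * c)).const_add 1
    have h2 : Tendsto (fun x : ℝ => log (1 + 2 * c / (x - c))) atTop (𝓝 0) := by
      simpa using h1.log (by norm_num)
    have h3 := ((h2.comp tendsto_cosh_atTop).div_const 2).const_mul (-c⁻¹)
    simp only [zero_div, mul_zero] at h3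
    refine h3.congr fun s => ?_
    have : cosh s - c ≠ 0 := by linarith [one_le_cosh s]
    simp only [Function.comp]
    congr 3
    field_simp
    ring
  rw [lintegral_Ioi_ofReal_of_hasDerivAt (l := 0) _ _ hl]
  · congr 1; ring
  · intro s _
    have := ((hasDerivAt_log_add_div_sub_right hc.le
      (h.trans_le (one_le_cosh s))).comp s (hasDerivAt_cosh s)).const_mul (-c⁻¹)
    refine this.congr_deriv ?_
    field_simp
  · intro s hs
    have := sq_lt_cosh_sq hc.le h s
    exact div_nonneg (sinh_nonneg_iff.2 (hr.trans hs).le) (by linarith)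

theorem lintegral_cosh_div_cosh_sq_sub_sq {b : ℝ} (hb : 0 ≤ b) (h : b < 1) :
    ∫⁻ r in Ioi 0, ENNReal.ofReal (cosh r / (cosh r ^ 2 - b ^ 2)) =
      ENNReal.ofReal (π / 2 / √(1 - b ^ 2)) := by
  have hk : 0 < √(1 - b ^ 2) := Real.sqrt_pos.2 (by nlinarith)
  have hk2 : √(1 - b ^ 2) ^ 2 = 1 - b ^ 2 := Real.sq_sqrt (by nlinarith)
  set k := √(1 - b ^ 2)
  have hl : Tendsto (fun r => arctan (sinh r / k) / k) atTop (𝓝 (π / 2 / k)) :=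
    ((tendsto_arctan_atTop.mono_right nhdsWithin_le_nhds).comp
      (tendsto_sinh_atTop.atTop_div_const hk)).div_const k
  rw [lintegral_Ioi_ofReal_of_hasDerivAt _ _ hl]
  · simp
  · intro r _
    refine (((hasDerivAt_sinh r).div_const k).arctan.div_const k).congr_deriv ?_
    have : cosh r ^ 2 - b ^ 2 = k ^ 2 + sinh r ^ 2 := by rw [hk2, cosh_sq]; ring
    rw [this]
    field_simp
  · intro r _
    have := sq_lt_cosh_sq hb h r
    exact div_nonneg (cosh_pos r).le (by linarith)

theorem lintegral_inv_Ioo {b : ℝ} (hb : 0 < b) (h : b < 1) :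
    ∫⁻ c in Ioo b 1, ENNReal.ofReal c⁻¹ = ENNReal.ofReal (-log b) := by
  rw [lintegral_Ioo_ofReal_of_hasDerivAt h.le
    (fun x hx => hasDerivAt_log (hb.trans_le hx.1).ne')]
  · simp
  · intro x hx
    exact inv_nonneg.2 (hb.trans hx.1).le

theorem image_sin_Ioo : sin '' Ioo 0 (π / 2) = Ioo 0 1 := by
  ext y
  constructor
  · rintro ⟨x, hx, rfl⟩
    refine ⟨sin_pos_of_pos_of_lt_pi hx.1 (by linarith [hx.2, pi_pos]), ?_⟩
    rw [← sin_pi_div_two]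
    exact sin_lt_sin_of_lt_of_le_pi_div_two (by linarith [hx.1, pi_pos]) le_rfl hx.2
  · intro hy
    exact ⟨arcsin y, ⟨arcsin_pos.2 hy.1, arcsin_lt_pi_div_two.2 hy.2⟩,
      sin_arcsin (by linarith [hy.1]) hy.2.le⟩

theorem lintegral_neg_log_div_sqrt :
    ∫⁻ b in Ioo (0 : ℝ) 1, ENNReal.ofReal (π / 2 / √(1 - b ^ 2)) * ENNReal.ofReal (-log b) =
      ENNReal.ofReal (π ^ 2 * log 2 / 4) := by
  have hinj : InjOn sin (Ioo 0 (π / 2)) :=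
    injOn_sin.mono (Ioo_subset_Icc_self.trans (Icc_subset_Icc_left (by linarith [pi_pos])))
  rw [← image_sin_Ioo, lintegral_image_eq_lintegral_abs_deriv_mul measurableSet_Ioo
    (fun x _ => (hasDerivAt_sin x).hasDerivWithinAt) hinj]
  have hpi : (0 : ℝ) ≤ π / 2 := by positivity
  have hi : IntegrableOn (fun x => π / 2 * -log (sin x)) (Ioo 0 (π / 2)) :=
    (((intervalIntegrable_iff_integrableOn_Ioo_of_le hpi).1
      (intervalIntegrable_log_sin (a := 0) (b := π / 2))).neg).const_mul (π / 2)
  have hnn : ∀ x ∈ Ioo 0 (π / 2), 0 ≤ π / 2 * -log (sin x) := fun x hx =>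
    mul_nonneg hpi (neg_nonneg.2 (log_nonpos
      (sin_nonneg_of_nonneg_of_le_pi hx.1.le (by linarith [hx.2, pi_pos])) (sin_le_one x)))
  have hint : ∫ x in Ioo 0 (π / 2), π / 2 * -log (sin x) = π ^ 2 * log 2 / 4 := by
    rw [← integral_Ioc_eq_integral_Ioo, ← intervalIntegral.integral_of_le hpi,
      intervalIntegral.integral_const_mul, intervalIntegral.integral_neg,
      integral_log_sin_zero_pi_div_two]
    ring
  rw [← hint, ofReal_integral_eq_lintegral_ofReal hi
    ((ae_restrict_iff' measurableSet_Ioo).2 (ae_of_all _ hnn))]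
  refine setLIntegral_congr_fun measurableSet_Ioo fun x hx => ?_
  have hcos : 0 < cos x := cos_pos_of_mem_Ioo ⟨by linarith [hx.1, pi_pos], hx.2⟩
  have hsq : √(1 - sin x ^ 2) = cos x := by
    rw [← cos_sq', Real.sqrt_sq hcos.le]
  simp only [hsq, abs_of_pos hcos]
  rw [← mul_assoc, ← ENNReal.ofReal_mul hcos.le, ← ENNReal.ofReal_mul (by positivity)]
  congr 2
  field_simp

theorem log_cosh_add_one_div_sub_one {s : ℝ} (hs : 0 < s) :
    log ((cosh s + 1) / (cosh s - 1)) / 2 = -log (tanh (s / 2)) := by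
  have hsh : 0 < sinh (s / 2) := sinh_pos_iff.2 (by linarith)
  have hch := cosh_pos (s / 2)
  have h2 := cosh_two_mul (s / 2)
  rw [mul_div_cancel₀ s two_ne_zero] at h2
  have h3 := cosh_sq (s / 2)
  have : (cosh s + 1) / (cosh s - 1) = ((tanh (s / 2))⁻¹) ^ 2 := by
    rw [show cosh s + 1 = 2 * cosh (s / 2) ^ 2 by linarith,
      show cosh s - 1 = 2 * sinh (s / 2) ^ 2 by linarith, tanh_eq_sinh_div_cosh]
    field_simp
  rw [this, log_pow, log_inv]
  push_cast
  ring

theorem lintegral_mul_sinh_div_cosh_sq_sub_sq {s : ℝ} (hs : 0 < s) :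
    ∫⁻ c in Ioo (0 : ℝ) 1, ENNReal.ofReal s * ENNReal.ofReal (sinh s / (cosh s ^ 2 - c ^ 2)) =
      ENNReal.ofReal (s * tanh s * -log (tanh (s / 2))) := by
  have ht : 0 < tanh s := by
    rw [tanh_eq_sinh_div_cosh]; exact div_pos (sinh_pos_iff.2 hs) (cosh_pos s)
  rw [← log_cosh_add_one_div_sub_one hs, ENNReal.ofReal_mul (by positivity),
    ← lintegral_div_sq_sub_sq zero_le_one (one_lt_cosh.2 hs.ne'),
    ← lintegral_const_mul' _ _ ENNReal.ofReal_ne_top]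
  refine lintegral_congr fun c => ?_
  rw [← ENNReal.ofReal_mul hs.le, ← ENNReal.ofReal_mul (by positivity), tanh_eq_sinh_div_cosh]
  congr 1
  have := (cosh_pos s).ne'
  field_simp

/-- Writing `s = ∫₀ˢ dr` and exchanging the two integrations. -/
theorem lintegral_Ioi_mul_sinh_div_cosh_sq_sub_sq {c : ℝ} (hc : 0 < c) (h : c < 1) :
    ∫⁻ s in Ioi (0 : ℝ), ENNReal.ofReal s * ENNReal.ofReal (sinh s / (cosh s ^ 2 - c ^ 2)) =
      ∫⁻ b in Ioo 0 c, ENNReal.ofReal c⁻¹ * ENNReal.ofReal (π / 2 / √(1 - b ^ 2)) := by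
  have hc' : 0 ≤ c⁻¹ := by positivity
  calc
    _ = ∫⁻ s in Ioi (0 : ℝ), ∫⁻ _ in Iio s ∩ Ioi 0,
        ENNReal.ofReal (sinh s / (cosh s ^ 2 - c ^ 2)) := by
      refine lintegral_congr fun s => ?_
      rw [setLIntegral_const, inter_comm, Ioi_inter_Iio, Real.volume_Ioo, sub_zero, mul_comm]
    _ = ∫⁻ r in Ioi (0 : ℝ), ∫⁻ s in Ioi r ∩ Ioi 0,
        ENNReal.ofReal (sinh s / (cosh s ^ 2 - c ^ 2)) :=
      lintegral_lintegral_lt_swap _ (by unfold Function.uncurry; fun_prop)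
    _ = ∫⁻ r in Ioi (0 : ℝ), ∫⁻ b in Ioo 0 c,
        ENNReal.ofReal c⁻¹ * ENNReal.ofReal (cosh r / (cosh r ^ 2 - b ^ 2)) := by
      refine setLIntegral_congr_fun measurableSet_Ioi fun r hr => ?_
      rw [inter_eq_left.2 (Ioi_subset_Ioi (le_of_lt hr)),
        lintegral_sinh_div_cosh_sq_sub_sq hc h hr, ENNReal.ofReal_mul hc',
        lintegral_const_mul' _ _ ENNReal.ofReal_ne_top,
        lintegral_div_sq_sub_sq hc.le (h.trans_le (one_le_cosh r))]
    _ = ∫⁻ b in Ioo 0 c, ∫⁻ r in Ioi (0 : ℝ),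
        ENNReal.ofReal c⁻¹ * ENNReal.ofReal (cosh r / (cosh r ^ 2 - b ^ 2)) :=
      lintegral_lintegral_swap (by unfold Function.uncurry; fun_prop)
    _ = _ := by
      refine setLIntegral_congr_fun measurableSet_Ioo fun b hb => ?_
      rw [lintegral_const_mul' _ _ ENNReal.ofReal_ne_top,
        lintegral_cosh_div_cosh_sq_sub_sq hb.1.le (hb.2.trans h)]

theorem lintegral_mul_tanh_mul_neg_log_tanh :
    ∫⁻ s in Ioi (0 : ℝ), ENNReal.ofReal (s * tanh s * -log (tanh (s / 2))) =
      ENNReal.ofReal (π ^ 2 * log 2 / 4) := by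
  calc
    _ = ∫⁻ s in Ioi (0 : ℝ), ∫⁻ c in Ioo (0 : ℝ) 1,
        ENNReal.ofReal s * ENNReal.ofReal (sinh s / (cosh s ^ 2 - c ^ 2)) :=
      setLIntegral_congr_fun measurableSet_Ioi fun s hs =>
        (lintegral_mul_sinh_div_cosh_sq_sub_sq hs).symm
    _ = ∫⁻ c in Ioo (0 : ℝ) 1, ∫⁻ s in Ioi (0 : ℝ),
        ENNReal.ofReal s * ENNReal.ofReal (sinh s / (cosh s ^ 2 - c ^ 2)) :=
      lintegral_lintegral_swap (by unfold Function.uncurry; fun_prop)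
    _ = ∫⁻ c in Ioo (0 : ℝ) 1, ∫⁻ b in Iio c ∩ Ioo 0 1,
        ENNReal.ofReal c⁻¹ * ENNReal.ofReal (π / 2 / √(1 - b ^ 2)) := by
      refine setLIntegral_congr_fun measurableSet_Ioo fun c hc => ?_
      rw [lintegral_Ioi_mul_sinh_div_cosh_sq_sub_sq hc.1 hc.2, inter_comm, Ioo_inter_Iio,
        min_eq_right hc.2.le]
    _ = ∫⁻ b in Ioo (0 : ℝ) 1, ∫⁻ c in Ioi b ∩ Ioo 0 1,
        ENNReal.ofReal c⁻¹ * ENNReal.ofReal (π / 2 / √(1 - b ^ 2)) :=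
      lintegral_lintegral_lt_swap _ (by unfold Function.uncurry; fun_prop)
    _ = ∫⁻ b in Ioo (0 : ℝ) 1,
        ENNReal.ofReal (π / 2 / √(1 - b ^ 2)) * ENNReal.ofReal (-log b) := by
      refine setLIntegral_congr_fun measurableSet_Ioo fun b hb => ?_
      rw [lintegral_mul_const' _ _ ENNReal.ofReal_ne_top, Ioi_inter_Ioo, max_eq_left hb.1.le,
        lintegral_inv_Ioo hb.1 hb.2, mul_comm]
    _ = _ := lintegral_neg_log_div_sqrt

theorem integral_mul_tanh_mul_neg_log_tanh :
    ∫ s in Ioi (0 : ℝ), s * tanh s * -log (tanh (s / 2)) = π ^ 2 * log 2 / 4 := by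
  have hm : Measurable tanh := by
    have : tanh = fun x => sinh x / cosh x := funext tanh_eq_sinh_div_cosh
    rw [this]; fun_prop
  rw [integral_eq_lintegral_of_nonneg_ae, lintegral_mul_tanh_mul_neg_log_tanh,
    ENNReal.toReal_ofReal (by positivity)]
  · refine (ae_restrict_iff' measurableSet_Ioi).2 (ae_of_all _ fun s (hs : 0 < s) => ?_)
    have h1 : ∀ x : ℝ, 0 < x → 0 ≤ tanh x := fun x hx => by
      rw [tanh_eq_sinh_div_cosh]; exact div_nonneg (sinh_nonneg_iff.2 hx.le) (cosh_pos x).le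
    exact mul_nonneg (mul_nonneg hs.le (h1 s hs))
      (neg_nonneg.2 (log_nonpos (h1 _ (by positivity)) (tanh_lt_one _).le))
  · exact Measurable.aestronglyMeasurable (by fun_prop)

/-- ∫₀^∞ t·tanh(t/2)·log(tanh(t/4)) dt = −π² log 2. -/
theorem tanh_log_tanh_integral :
    (∫ t in Ioi (0 : ℝ), t * Real.tanh (t / 2) * Real.log (Real.tanh (t / 4))) =
      -(π ^ 2 * Real.log 2) := by
  have key := integral_comp_mul_left_Ioi (fun s => s * tanh s * -log (tanh (s / 2))) 0
    (b := 1 / 2) (by norm_num)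
  rw [mul_zero, integral_mul_tanh_mul_neg_log_tanh] at key
  have : ∀ t : ℝ, t * Real.tanh (t / 2) * Real.log (Real.tanh (t / 4)) =
      -2 * (1 / 2 * t * tanh (1 / 2 * t) * -log (tanh (1 / 2 * t / 2))) := fun t => by
    rw [show 1 / 2 * t / 2 = t / 4 by ring, show 1 / 2 * t = t / 2 by ring]; ring
  simp_rw [this]
  rw [integral_const_mul, key, smul_eq_mul]
  ring
end

section
/- The function H(τ) = −(4/π²)·tanh(τ/2)·log(tanh(τ/4)) is a probability density on (0,∞), and a random variable with this density has expected value 4·log 2. -/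
open MeasureTheory Real Set

open Filter Topology

lemma sinh_eq_half (t : ℝ) : sinh t = 2 * sinh (t / 2) * cosh (t / 2) := by
  rw [← sinh_two_mul]; congr 1; ring

lemma mul_exp_half_le_two_mul_sinh {t : ℝ} (ht : 0 ≤ t) : t * exp (t / 2) ≤ 2 * sinh t := by
  have h2 : t / 2 ≤ sinh (t / 2) := self_le_sinh_iff.2 (by positivity)
  have h3 : exp (t / 2) ≤ 2 * cosh (t / 2) := by
    rw [cosh_eq]; linarith [exp_pos (-(t / 2))]
  rw [sinh_eq_half]
  nlinarith [mul_le_mul h2 h3 (exp_pos _).le (by linarith)]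

lemma mul_exp_half_le_exp_sub_one {t : ℝ} (ht : 0 ≤ t) : t * exp (t / 2) ≤ exp t - 1 := by
  have h1 : exp t - 1 = exp (t / 2) * (2 * sinh (t / 2)) := by
    rw [sinh_eq, mul_div_cancel₀ _ two_ne_zero, mul_sub, ← exp_add, ← exp_add]
    simp
  have h2 : t / 2 ≤ sinh (t / 2) := self_le_sinh_iff.2 (by positivity)
  rw [h1]
  nlinarith [exp_pos (t / 2)]

lemma integral_mul_exp_neg_mul_Ioi {b : ℝ} (hb : 0 < b) :
    ∫ t in Ioi (0 : ℝ), t * exp (-(b * t)) = 1 / b ^ 2 := by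
  have h := integral_rpow_mul_exp_neg_mul_Ioi (a := 2) two_pos hb
  have h2 : Gamma 2 = 1 := by simp
  norm_num [h2] at h
  simpa using h

lemma integrableOn_mul_exp_neg_mul_Ioi {b : ℝ} (hb : 0 < b) :
    IntegrableOn (fun t : ℝ ↦ t * exp (-(b * t))) (Ioi 0) :=
  .of_integral_ne_zero (by rw [integral_mul_exp_neg_mul_Ioi hb]; positivity)

lemma hasSum_one_div_odd_sq :
    HasSum (fun k : ℕ ↦ 1 / (2 * (k : ℝ) + 1) ^ 2) (π ^ 2 / 8) := by
  have h := hasSum_zeta_two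
  have he : HasSum (fun k : ℕ ↦ (1 : ℝ) / ((2 * k : ℕ) : ℝ) ^ 2) (π ^ 2 / 24) := by
    have h4 := h.mul_left (1 / 4)
    rw [show 1 / 4 * (π ^ 2 / 6) = π ^ 2 / 24 by ring] at h4
    refine h4.congr_fun fun k ↦ ?_
    push_cast
    ring
  have hs : Summable (fun k : ℕ ↦ (1 : ℝ) / ((2 * k + 1 : ℕ) : ℝ) ^ 2) :=
    h.summable.comp_injective (i := fun k : ℕ ↦ 2 * k + 1) (fun a b hab ↦ by simpa using hab)
  have hu := (he.even_add_odd (f := fun n : ℕ ↦ (1 : ℝ) / (n : ℝ) ^ 2) hs.hasSum).unique h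
  convert hs.hasSum using 1
  · ext k; push_cast; rfl
  · linarith

lemma hasSum_exp_neg_odd_mul {t : ℝ} (ht : 0 < t) :
    HasSum (fun k : ℕ ↦ exp (-((2 * (k : ℝ) + 1) * t))) (1 / (2 * sinh t)) := by
  have h1 : exp (-(2 * t)) < 1 := exp_lt_one_iff.2 (by linarith)
  have h := (hasSum_geometric_of_lt_one (exp_pos _).le h1).mul_left (exp (-t))
  have hsinh : 0 < sinh t := sinh_pos_iff.2 ht
  have h2 : 2 * sinh t * exp (-t) = 1 - exp (-(2 * t)) := by
    rw [sinh_eq, mul_div_cancel₀ _ two_ne_zero, sub_mul, ← exp_add, ← exp_add]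
    simp [two_mul]
  have h3 : exp (-t) * (1 - exp (-(2 * t)))⁻¹ = 1 / (2 * sinh t) := by
    rw [← h2]
    field_simp
  rw [h3] at h
  refine h.congr_fun fun k ↦ ?_
  rw [← exp_nat_mul, ← exp_add]
  congr 1
  ring

lemma integral_div_sinh_Ioi : ∫ t in Ioi (0 : ℝ), t / sinh t = π ^ 2 / 4 := by
  have hb (k : ℕ) : 0 < 2 * (k : ℝ) + 1 := by positivity
  have h := hasSum_integral_of_summable_integral_norm (μ := volume.restrict (Ioi (0 : ℝ)))
    (F := fun (k : ℕ) (t : ℝ) ↦ t * exp (-((2 * (k : ℝ) + 1) * t)))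
    (fun k ↦ integrableOn_mul_exp_neg_mul_Ioi (hb k)) (by
      refine hasSum_one_div_odd_sq.summable.congr fun k ↦ ?_
      rw [← integral_mul_exp_neg_mul_Ioi (hb k)]
      refine setIntegral_congr_fun measurableSet_Ioi fun t (ht : 0 < t) ↦ ?_
      exact (norm_of_nonneg (by positivity)).symm)
  simp only [integral_mul_exp_neg_mul_Ioi (hb _)] at h
  have h' := h.unique hasSum_one_div_odd_sq
  have h2 : ∫ t in Ioi (0 : ℝ), t / sinh t =
      ∫ t in Ioi (0 : ℝ), 2 * ∑' k : ℕ, t * exp (-((2 * (k : ℝ) + 1) * t)) := by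
    refine setIntegral_congr_fun measurableSet_Ioi fun t (ht : 0 < t) ↦ ?_
    have := sinh_pos_iff.2 ht
    simp only [((hasSum_exp_neg_odd_mul ht).mul_left t).tsum_eq]
    field_simp
  rw [h2, integral_const_mul, h']
  ring

lemma integrableOn_div_sinh : IntegrableOn (fun t : ℝ ↦ t / sinh t) (Ioi 0) :=
  .of_integral_ne_zero (by rw [integral_div_sinh_Ioi]; positivity)

lemma sq_div_sinh_le {t : ℝ} (ht : 0 < t) :
    t ^ 2 / sinh t ≤ 2 * (t * exp (-(1 / 2 * t))) := by
  rw [div_le_iff₀ (sinh_pos_iff.2 ht)]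
  have h2 := mul_le_mul_of_nonneg_left (mul_exp_half_le_two_mul_sinh ht.le)
    (by positivity : 0 ≤ t * exp (-(1 / 2 * t)))
  have h3 : exp (-(1 / 2 * t)) * exp (t / 2) = 1 := by rw [← exp_add]; simp; ring
  calc t ^ 2 = t * exp (-(1 / 2 * t)) * (t * exp (t / 2)) := by linear_combination (-t ^ 2) * h3
    _ ≤ _ := by linarith

/-- The change of variables formula for a decreasing involution of the positive half-line. -/
lemma integral_comp_involution {φ d : ℝ → ℝ} (hφ : ∀ t, 0 < t → 0 < φ t)
    (hinv : ∀ t, 0 < t → φ (φ t) = t) (hd : ∀ t, 0 < t → 0 ≤ d t)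
    (hderiv : ∀ t, 0 < t → HasDerivAt φ (-d t) t) (g : ℝ → ℝ) :
    (∫ t in Ioi (0 : ℝ), g t = ∫ t in Ioi (0 : ℝ), d t * g (φ t)) ∧
      (IntegrableOn g (Ioi 0) ↔ IntegrableOn (fun t ↦ d t * g (φ t)) (Ioi 0)) := by
  have himg : φ '' Ioi 0 = Ioi 0 := by
    ext x
    exact ⟨fun ⟨t, ht, h⟩ ↦ h ▸ hφ t ht, fun hx ↦ ⟨φ x, hφ x hx, hinv x hx⟩⟩
  have hinj : InjOn φ (Ioi 0) := fun a ha b hb h ↦ by rw [← hinv a ha, h, hinv b hb]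
  have hcongr : EqOn (fun t ↦ |(-d t)| • g (φ t)) (fun t ↦ d t * g (φ t)) (Ioi 0) :=
    fun t ht ↦ by simp [abs_of_nonneg (hd t ht)]
  have hderiv' : ∀ t ∈ Ioi (0 : ℝ), HasDerivWithinAt φ (-d t) (Ioi 0) t :=
    fun t ht ↦ (hderiv t ht).hasDerivWithinAt
  constructor
  · have := integral_image_eq_integral_abs_deriv_smul measurableSet_Ioi hderiv' hinj g
    rwa [himg, setIntegral_congr_fun measurableSet_Ioi hcongr] at this
  · have := integrableOn_image_iff_integrableOn_abs_deriv_smul measurableSet_Ioi hderiv' hinj g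
    rwa [himg, integrableOn_congr_fun hcongr measurableSet_Ioi] at this

/-- The decreasing involution `t ↦ -log (tanh (t / 2))` of the positive half-line. -/
noncomputable def negLogTanhHalf (t : ℝ) : ℝ := -log (tanh (t / 2))

lemma tanh_pos_of_pos {t : ℝ} (ht : 0 < t) : 0 < tanh t := by
  rw [tanh_eq_sinh_div_cosh]
  exact div_pos (sinh_pos_iff.2 ht) (cosh_pos t)

lemma negLogTanhHalf_pos {t : ℝ} (ht : 0 < t) : 0 < negLogTanhHalf t :=
  neg_pos.2 (log_neg (tanh_pos_of_pos (by positivity)) (tanh_lt_one _))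

lemma exp_negLogTanhHalf {t : ℝ} (ht : 0 < t) :
    exp (negLogTanhHalf t) = cosh (t / 2) / sinh (t / 2) := by
  rw [negLogTanhHalf, exp_neg, exp_log (tanh_pos_of_pos (by positivity)), tanh_eq_sinh_div_cosh,
    inv_div]

lemma sinh_negLogTanhHalf {t : ℝ} (ht : 0 < t) : sinh (negLogTanhHalf t) = 1 / sinh t := by
  have h1 : 0 < sinh (t / 2) := sinh_pos_iff.2 (by positivity)
  have h2 := cosh_pos (t / 2)
  have h3 := cosh_sq (t / 2)
  rw [sinh_eq, exp_neg, exp_negLogTanhHalf ht, sinh_eq_half t]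
  field_simp
  linarith

lemma cosh_negLogTanhHalf {t : ℝ} (ht : 0 < t) : cosh (negLogTanhHalf t) = cosh t / sinh t := by
  have h1 : 0 < sinh (t / 2) := sinh_pos_iff.2 (by positivity)
  have h2 := cosh_pos (t / 2)
  have h3 : cosh t = cosh (t / 2) ^ 2 + sinh (t / 2) ^ 2 := by
    rw [← cosh_two_mul]; congr 1; ring
  rw [cosh_eq, exp_neg, exp_negLogTanhHalf ht, sinh_eq_half t, h3]
  field_simp

lemma negLogTanhHalf_negLogTanhHalf {t : ℝ} (ht : 0 < t) :
    negLogTanhHalf (negLogTanhHalf t) = t := by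
  apply sinh_injective
  rw [sinh_negLogTanhHalf (negLogTanhHalf_pos ht), sinh_negLogTanhHalf ht, one_div_one_div]

lemma hasDerivAt_negLogTanhHalf {t : ℝ} (ht : 0 < t) :
    HasDerivAt negLogTanhHalf (-(1 / sinh t)) t := by
  have h1 : 0 < sinh (t / 2) := sinh_pos_iff.2 (by positivity)
  have h2 := cosh_pos (t / 2)
  have h3 := cosh_sq (t / 2)
  have hh : HasDerivAt (fun x : ℝ ↦ x / 2) (1 / 2) t := (hasDerivAt_id t).div_const 2
  have h := ((hh.sinh.div hh.cosh h2.ne').log (div_pos h1 h2).ne').neg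
  have he : negLogTanhHalf = fun x ↦ -log (sinh (x / 2) / cosh (x / 2)) := by
    ext x; rw [negLogTanhHalf, tanh_eq_sinh_div_cosh]
  rw [he]
  refine h.congr_deriv ?_
  simp only [Pi.div_apply]
  rw [sinh_eq_half t]
  field_simp
  linarith

lemma integral_comp_negLogTanhHalf (g : ℝ → ℝ) :
    (∫ t in Ioi (0 : ℝ), g t = ∫ t in Ioi (0 : ℝ), 1 / sinh t * g (negLogTanhHalf t)) ∧
      (IntegrableOn g (Ioi 0) ↔
        IntegrableOn (fun t ↦ 1 / sinh t * g (negLogTanhHalf t)) (Ioi 0)) :=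
  integral_comp_involution (fun _ ↦ negLogTanhHalf_pos) (fun _ ↦ negLogTanhHalf_negLogTanhHalf)
    (fun _ ht ↦ (one_div_pos.2 (sinh_pos_iff.2 ht)).le) (fun _ ↦ hasDerivAt_negLogTanhHalf) g

lemma measurable_negLogTanhHalf : Measurable negLogTanhHalf := by
  have he : negLogTanhHalf = fun x ↦ -log (sinh (x / 2) / cosh (x / 2)) := by
    ext x; rw [negLogTanhHalf, tanh_eq_sinh_div_cosh]
  rw [he]
  fun_prop

lemma integral_negLogTanhHalf : ∫ t in Ioi (0 : ℝ), negLogTanhHalf t = π ^ 2 / 4 := by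
  rw [(integral_comp_negLogTanhHalf negLogTanhHalf).1, ← integral_div_sinh_Ioi]
  refine setIntegral_congr_fun measurableSet_Ioi fun t (ht : 0 < t) ↦ ?_
  simp only [negLogTanhHalf_negLogTanhHalf ht]
  ring

lemma integrableOn_negLogTanhHalf : IntegrableOn negLogTanhHalf (Ioi 0) :=
  .of_integral_ne_zero (by rw [integral_negLogTanhHalf]; positivity)

lemma negLogTanhHalf_le {t : ℝ} (ht : 0 < t) : negLogTanhHalf t ≤ 1 / sinh t := by
  rw [← sinh_negLogTanhHalf ht]
  exact self_le_sinh_iff.2 (negLogTanhHalf_pos ht).le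

lemma integrableOn_mul_negLogTanhHalf :
    IntegrableOn (fun t ↦ t * negLogTanhHalf t) (Ioi 0) := by
  refine Integrable.mono' integrableOn_div_sinh
    (measurable_id.mul measurable_negLogTanhHalf).aestronglyMeasurable ?_
  filter_upwards [ae_restrict_mem measurableSet_Ioi] with t (ht : 0 < t)
  have h := negLogTanhHalf_pos ht
  rw [norm_of_nonneg (by positivity)]
  calc t * negLogTanhHalf t ≤ t * (1 / sinh t) := by gcongr; exact negLogTanhHalf_le ht
    _ = t / sinh t := by ring

/-- The decreasing involution `t ↦ -log (1 - exp (-t))` of the positive half-line. -/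
noncomputable def negLogOneSubExp (t : ℝ) : ℝ := -log (1 - exp (-t))

lemma one_sub_exp_neg_pos {t : ℝ} (ht : 0 < t) : 0 < 1 - exp (-t) :=
  sub_pos.2 (exp_lt_one_iff.2 (neg_lt_zero.2 ht))

lemma exp_sub_one_pos {t : ℝ} (ht : 0 < t) : 0 < exp t - 1 := sub_pos.2 (one_lt_exp_iff.2 ht)

lemma one_div_exp_sub_one {t : ℝ} (ht : 0 < t) :
    1 / (exp t - 1) = (1 - exp (-t))⁻¹ - 1 := by
  have h1 := one_sub_exp_neg_pos ht
  have h2 := exp_sub_one_pos ht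
  have h3 : exp (-t) * exp t = 1 := by rw [← exp_add]; simp
  field_simp
  linarith

lemma negLogOneSubExp_pos {t : ℝ} (ht : 0 < t) : 0 < negLogOneSubExp t :=
  neg_pos.2 (log_neg (one_sub_exp_neg_pos ht) (by linarith [exp_pos (-t)]))

lemma exp_neg_negLogOneSubExp {t : ℝ} (ht : 0 < t) :
    exp (-negLogOneSubExp t) = 1 - exp (-t) := by
  rw [negLogOneSubExp, neg_neg, exp_log (one_sub_exp_neg_pos ht)]

lemma negLogOneSubExp_negLogOneSubExp {t : ℝ} (ht : 0 < t) :
    negLogOneSubExp (negLogOneSubExp t) = t := by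
  rw [negLogOneSubExp, exp_neg_negLogOneSubExp ht]
  simp

lemma hasDerivAt_negLogOneSubExp {t : ℝ} (ht : 0 < t) :
    HasDerivAt negLogOneSubExp (-(1 / (exp t - 1))) t := by
  have h1 := one_sub_exp_neg_pos ht
  refine ((((hasDerivAt_id t).neg.exp).const_sub 1).log h1.ne').neg.congr_deriv ?_
  rw [one_div_exp_sub_one ht]
  simp only [id, Pi.neg_apply]
  field_simp
  ring

lemma negLogOneSubExp_le {t : ℝ} (ht : 0 < t) : negLogOneSubExp t ≤ 1 / (exp t - 1) := by
  rw [negLogOneSubExp, ← log_inv, one_div_exp_sub_one ht]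
  exact log_le_sub_one_of_pos (inv_pos.2 (one_sub_exp_neg_pos ht))

lemma measurable_negLogOneSubExp : Measurable negLogOneSubExp := by
  unfold negLogOneSubExp
  fun_prop

lemma mul_one_div_exp_sub_one_le {t : ℝ} (ht : 0 < t) :
    t * (1 / (exp t - 1)) ≤ exp (-(1 / 2 * t)) := by
  rw [mul_one_div, div_le_iff₀ (exp_sub_one_pos ht)]
  have h2 := mul_le_mul_of_nonneg_left (mul_exp_half_le_exp_sub_one ht.le)
    (exp_pos (-(1 / 2 * t))).le
  have h3 : exp (-(1 / 2 * t)) * exp (t / 2) = 1 := by rw [← exp_add]; simp; ring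
  calc t = exp (-(1 / 2 * t)) * (t * exp (t / 2)) := by linear_combination (-t) * h3
    _ ≤ _ := h2

lemma mul_negLogOneSubExp_le {t : ℝ} (ht : 0 < t) :
    t * negLogOneSubExp t ≤ exp (-(1 / 2 * t)) :=
  (mul_le_mul_of_nonneg_left (negLogOneSubExp_le ht) ht.le).trans (mul_one_div_exp_sub_one_le ht)

lemma integrableOn_mul_negLogOneSubExp :
    IntegrableOn (fun t ↦ t * negLogOneSubExp t) (Ioi 0) := by
  have h := integrableOn_exp_mul_Ioi (a := -(1 / 2)) (by norm_num) 0
  refine Integrable.mono' h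
    (measurable_id.mul measurable_negLogOneSubExp).aestronglyMeasurable ?_
  filter_upwards [ae_restrict_mem measurableSet_Ioi] with t (ht : 0 < t)
  have h1 := negLogOneSubExp_pos ht
  rw [norm_of_nonneg (by positivity), neg_mul]
  exact mul_negLogOneSubExp_le ht

lemma integrableOn_sq_div_exp_sub_one :
    IntegrableOn (fun t ↦ t ^ 2 * (1 / (exp t - 1))) (Ioi 0) := by
  have h := integrableOn_mul_exp_neg_mul_Ioi (b := 1 / 2) (by norm_num)
  refine Integrable.mono' h (by fun_prop) ?_
  filter_upwards [ae_restrict_mem measurableSet_Ioi] with t (ht : 0 < t)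
  have h1 := exp_sub_one_pos ht
  rw [norm_of_nonneg (by positivity), sq, mul_assoc]
  exact mul_le_mul_of_nonneg_left (mul_one_div_exp_sub_one_le ht) ht.le

lemma tendsto_mul_exp_neg_half_atTop :
    Tendsto (fun t : ℝ ↦ t * exp (-(1 / 2 * t))) atTop (𝓝 0) := by
  have h1 : Tendsto (fun t : ℝ ↦ 1 / 2 * t) atTop atTop :=
    tendsto_id.const_mul_atTop (by norm_num)
  have h := ((tendsto_pow_mul_exp_neg_atTop_nhds_zero 1).comp h1).const_mul 2
  rw [mul_zero] at h
  refine h.congr fun t ↦ ?_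
  simp only [Function.comp]
  ring

/-- The fundamental theorem of calculus on the positive half-line for a function that vanishes at
both ends. -/
lemma integral_Ioi_eq_zero_of_hasDerivAt {F f B : ℝ → ℝ} (hF : F 0 = 0)
    (hderiv : ∀ t, 0 < t → HasDerivAt F (f t) t) (hf : IntegrableOn f (Ioi 0))
    (hB : ∀ t, 0 < t → |F t| ≤ B t) (hB0 : Tendsto B (𝓝[>] 0) (𝓝 0))
    (hBtop : Tendsto B atTop (𝓝 0)) : ∫ t in Ioi (0 : ℝ), f t = 0 := by
  have h0 : ContinuousWithinAt F (Ici 0) 0 := by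
    rw [← continuousWithinAt_Ioi_iff_Ici, ContinuousWithinAt, hF]
    refine squeeze_zero_norm' ?_ hB0
    filter_upwards [self_mem_nhdsWithin] with t ht using hB t ht
  have htop : Tendsto F atTop (𝓝 0) := by
    refine squeeze_zero_norm' ?_ hBtop
    filter_upwards [eventually_gt_atTop 0] with t ht using hB t ht
  rw [integral_Ioi_of_hasDerivAt_of_tendsto h0 hderiv hf htop, hF, sub_zero]

lemma integral_sq_div_exp_sub_one :
    ∫ t in Ioi (0 : ℝ), t ^ 2 * (1 / (exp t - 1)) =
      2 * ∫ t in Ioi (0 : ℝ), t * negLogOneSubExp t := by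
  have hcont : Continuous fun t : ℝ ↦ t * exp (-(1 / 2 * t)) := by fun_prop
  have h1 := integrableOn_mul_negLogOneSubExp.const_mul 2
  have h2 : IntegrableOn (fun t ↦ 2 * (t * negLogOneSubExp t) - t ^ 2 * (1 / (exp t - 1)))
      (Ioi 0) := h1.sub integrableOn_sq_div_exp_sub_one
  have h := integral_Ioi_eq_zero_of_hasDerivAt
    (F := fun t ↦ t ^ 2 * negLogOneSubExp t)
    (B := fun t ↦ t * exp (-(1 / 2 * t))) (by simp)
    (fun t ht ↦ ((hasDerivAt_pow 2 t).mul (hasDerivAt_negLogOneSubExp ht)).congr_deriv (by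
      simp; ring))
    h2
    (fun t ht ↦ by
      have := negLogOneSubExp_pos ht
      rw [abs_of_nonneg (by positivity), sq, mul_assoc]
      exact mul_le_mul_of_nonneg_left (mul_negLogOneSubExp_le ht) ht.le)
    (by simpa using (hcont.tendsto 0).mono_left nhdsWithin_le_nhds)
    tendsto_mul_exp_neg_half_atTop
  rw [integral_sub h1 integrableOn_sq_div_exp_sub_one,
    integral_const_mul] at h
  linarith

lemma integral_negLogOneSubExp_sq :
    IntegrableOn (fun t ↦ negLogOneSubExp t ^ 2) (Ioi 0) ∧
      ∫ t in Ioi (0 : ℝ), negLogOneSubExp t ^ 2 =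
        2 * ∫ t in Ioi (0 : ℝ), t * negLogOneSubExp t := by
  obtain ⟨h1, h2⟩ := integral_comp_involution (fun _ ↦ negLogOneSubExp_pos)
    (fun _ ↦ negLogOneSubExp_negLogOneSubExp)
    (fun _ ht ↦ (one_div_pos.2 (exp_sub_one_pos ht)).le) (fun _ ↦ hasDerivAt_negLogOneSubExp)
    (fun t ↦ negLogOneSubExp t ^ 2)
  have hcongr : EqOn (fun t ↦ 1 / (exp t - 1) * negLogOneSubExp (negLogOneSubExp t) ^ 2)
      (fun t ↦ t ^ 2 * (1 / (exp t - 1))) (Ioi 0) := fun t ht ↦ by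
    simp only [negLogOneSubExp_negLogOneSubExp ht]
    ring
  rw [setIntegral_congr_fun measurableSet_Ioi hcongr, integral_sq_div_exp_sub_one] at h1
  rw [integrableOn_congr_fun hcongr measurableSet_Ioi] at h2
  exact ⟨h2.2 integrableOn_sq_div_exp_sub_one, h1⟩

lemma negLogOneSubExp_image_Ioi_log_two :
    negLogOneSubExp '' Ioi (log 2) = Ioo 0 (log 2) := by
  have key : ∀ t, 0 < t → log 2 < t → negLogOneSubExp t < log 2 := fun t ht h ↦ by
    have h1 : exp (-t) < 1 / 2 := by
      rw [exp_neg, one_div]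
      exact inv_strictAnti₀ two_pos ((log_lt_iff_lt_exp two_pos).1 h)
    rw [negLogOneSubExp, ← log_inv]
    refine log_lt_log (inv_pos.2 (one_sub_exp_neg_pos ht)) ?_
    rw [inv_lt_comm₀ (one_sub_exp_neg_pos ht) two_pos]
    linarith
  have key' : ∀ t, 0 < t → t < log 2 → log 2 < negLogOneSubExp t := fun t ht h ↦ by
    have h1 : 1 / 2 < exp (-t) := by
      rw [exp_neg, one_div]
      exact inv_strictAnti₀ (exp_pos t) ((lt_log_iff_exp_lt two_pos).1 h)
    rw [negLogOneSubExp, ← log_inv]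
    refine log_lt_log two_pos ?_
    rw [lt_inv_comm₀ two_pos (one_sub_exp_neg_pos ht)]
    linarith
  have h2 : 0 < log 2 := log_pos one_lt_two
  ext x
  constructor
  · rintro ⟨t, ht, rfl⟩
    exact ⟨negLogOneSubExp_pos (h2.trans ht), key t (h2.trans ht) ht⟩
  · rintro ⟨hx, hx'⟩
    exact ⟨negLogOneSubExp x, key' x hx hx', negLogOneSubExp_negLogOneSubExp hx⟩

lemma integral_Ioi_log_two_mul_negLogOneSubExp :
    IntegrableOn (fun t ↦ t * negLogOneSubExp t * (1 - exp (-t))⁻¹) (Ioi (log 2)) ∧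
      ∫ t in Ioi (log 2), t * negLogOneSubExp t * (1 - exp (-t))⁻¹ =
        ∫ t in Ioi (0 : ℝ), t * negLogOneSubExp t := by
  have hlog : 0 < log 2 := log_pos one_lt_two
  have hinj : InjOn negLogOneSubExp (Ioi (log 2)) := fun a ha b hb h ↦ by
    rw [← negLogOneSubExp_negLogOneSubExp (hlog.trans ha), h,
      negLogOneSubExp_negLogOneSubExp (hlog.trans hb)]
  have hderiv : ∀ t ∈ Ioi (log 2),
      HasDerivWithinAt negLogOneSubExp (-(1 / (exp t - 1))) (Ioi (log 2)) t :=
    fun t ht ↦ (hasDerivAt_negLogOneSubExp (hlog.trans ht)).hasDerivWithinAt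
  have hcongr : EqOn
      (fun t ↦ |-(1 / (exp t - 1))| • (negLogOneSubExp t * negLogOneSubExp (negLogOneSubExp t)))
      (fun t ↦ t * negLogOneSubExp t * (1 / (exp t - 1))) (Ioi (log 2)) := fun t ht ↦ by
    have ht0 : 0 < t := hlog.trans ht
    simp only [negLogOneSubExp_negLogOneSubExp ht0, abs_neg,
      abs_of_pos (one_div_pos.2 (exp_sub_one_pos ht0)), smul_eq_mul]
    ring
  have h1 := integral_image_eq_integral_abs_deriv_smul measurableSet_Ioi hderiv hinj
    (fun t ↦ t * negLogOneSubExp t)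
  have h2 := integrableOn_image_iff_integrableOn_abs_deriv_smul measurableSet_Ioi hderiv hinj
    (fun t ↦ t * negLogOneSubExp t)
  rw [negLogOneSubExp_image_Ioi_log_two] at h1 h2
  rw [setIntegral_congr_fun measurableSet_Ioi hcongr, ← integral_Ioc_eq_integral_Ioo] at h1
  rw [integrableOn_congr_fun hcongr measurableSet_Ioi] at h2
  have hint := integrableOn_mul_negLogOneSubExp
  have h3 := h2.1 (hint.mono_set fun t ht ↦ ht.1)
  have h4 := hint.mono_set (Ioi_subset_Ioi hlog.le)
  have hsum : EqOn (fun t ↦ t * negLogOneSubExp t + t * negLogOneSubExp t * (1 / (exp t - 1)))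
      (fun t ↦ t * negLogOneSubExp t * (1 - exp (-t))⁻¹) (Ioi (log 2)) := fun t ht ↦ by
    simp only [one_div_exp_sub_one (hlog.trans ht)]
    ring
  refine ⟨(h4.add h3).congr_fun hsum measurableSet_Ioi, ?_⟩
  rw [← setIntegral_congr_fun measurableSet_Ioi hsum, integral_add h4 h3, ← h1,
    ← Ioc_union_Ioi_eq_Ioi hlog.le, setIntegral_union (Ioc_disjoint_Ioi le_rfl) measurableSet_Ioi
      (hint.mono_set fun t ht ↦ ht.1) h4, add_comm]

lemma image_log_one_add_exp : (fun t ↦ log (1 + exp t)) '' Ioi 0 = Ioi (log 2) := by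
  ext x
  constructor
  · rintro ⟨t, ht, rfl⟩
    exact log_lt_log two_pos (by linarith [one_lt_exp_iff.2 ht])
  · intro hx
    have h : 2 < exp x := (log_lt_iff_lt_exp two_pos).1 hx
    refine ⟨log (exp x - 1), log_pos (by linarith), ?_⟩
    simp only
    rw [exp_log (by linarith)]
    simp

lemma integral_log_one_add_exp_neg_mul :
    IntegrableOn (fun t ↦ log (1 + exp (-t)) * (t + log (1 + exp (-t)))) (Ioi 0) ∧
      ∫ t in Ioi (0 : ℝ), log (1 + exp (-t)) * (t + log (1 + exp (-t))) =
        ∫ t in Ioi (0 : ℝ), t * negLogOneSubExp t := by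
  have hinj : InjOn (fun t ↦ log (1 + exp t)) (Ioi 0) := fun a _ b _ h ↦ by
    have := log_injOn_pos (show 0 < 1 + exp a by positivity) (show 0 < 1 + exp b by positivity) h
    exact exp_injective (by linarith)
  have hderiv : ∀ t ∈ Ioi (0 : ℝ),
      HasDerivWithinAt (fun t ↦ log (1 + exp t)) (exp t / (1 + exp t)) (Ioi 0) t :=
    fun t _ ↦ (((hasDerivAt_exp t).const_add 1).log (by positivity)).hasDerivWithinAt
  have hcongr : EqOn (fun t ↦ |exp t / (1 + exp t)| • (log (1 + exp t) *
      negLogOneSubExp (log (1 + exp t)) * (1 - exp (-log (1 + exp t)))⁻¹))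
      (fun t ↦ log (1 + exp (-t)) * (t + log (1 + exp (-t)))) (Ioi 0) := fun t _ ↦ by
    have h1 : log (1 + exp t) = t + log (1 + exp (-t)) := by
      nth_rw 2 [← log_exp t]
      rw [← log_mul (by positivity) (by positivity), mul_add, ← exp_add]
      simp [add_comm]
    have h2 : 1 - exp (-log (1 + exp t)) = exp t / (1 + exp t) := by
      rw [exp_neg, exp_log (by positivity)]
      field_simp
      ring
    have h3 : negLogOneSubExp (log (1 + exp t)) = log (1 + exp (-t)) := by
      rw [negLogOneSubExp, h2, log_div (by positivity) (by positivity), log_exp, h1]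
      ring
    have h4 : 0 < exp t / (1 + exp t) := by positivity
    beta_reduce
    rw [h2, h3, h1, abs_of_pos h4, smul_eq_mul]
    field_simp
  have h1 := integral_image_eq_integral_abs_deriv_smul measurableSet_Ioi hderiv hinj
    (fun t ↦ t * negLogOneSubExp t * (1 - exp (-t))⁻¹)
  have h2 := integrableOn_image_iff_integrableOn_abs_deriv_smul measurableSet_Ioi hderiv hinj
    (fun t ↦ t * negLogOneSubExp t * (1 - exp (-t))⁻¹)
  rw [image_log_one_add_exp] at h1 h2
  rw [setIntegral_congr_fun measurableSet_Ioi hcongr] at h1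
  rw [integrableOn_congr_fun hcongr measurableSet_Ioi] at h2
  obtain ⟨h3, h4⟩ := integral_Ioi_log_two_mul_negLogOneSubExp
  exact ⟨h2.1 h3, h1.symm.trans h4⟩

lemma negLogTanhHalf_eq {t : ℝ} (ht : 0 < t) :
    negLogTanhHalf t = log (1 + exp (-t)) + negLogOneSubExp t := by
  have h1 := one_sub_exp_neg_pos ht
  have h2 : tanh (t / 2) = (1 - exp (-t)) / (1 + exp (-t)) := by
    have h3 : exp (-t) = exp (-(t / 2)) * exp (-(t / 2)) := by rw [← exp_add]; congr 1; ring
    have h4 : exp (t / 2) * exp (-(t / 2)) = 1 := by rw [← exp_add]; simp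
    rw [tanh_eq, h3, div_eq_div_iff (by positivity) (by positivity)]
    linear_combination (2 * exp (-(t / 2))) * h4
  rw [negLogTanhHalf, h2, log_div h1.ne' (by positivity), negLogOneSubExp]
  ring

lemma log_two_mul_sinh {t : ℝ} (ht : 0 < t) :
    log (2 * sinh t) = t + log (1 + exp (-t)) - negLogOneSubExp t := by
  have h1 := one_sub_exp_neg_pos ht
  have h2 : 2 * sinh t = exp t * ((1 + exp (-t)) * (1 - exp (-t))) := by
    have h4 : exp t * exp (-t) = 1 := by rw [← exp_add]; simp
    rw [sinh_eq]
    linear_combination (exp (-t)) * h4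
  rw [h2, log_mul (by positivity) (by positivity), log_mul (by positivity) h1.ne', log_exp,
    negLogOneSubExp]
  ring

lemma integral_negLogTanhHalf_mul_log_two_mul_sinh :
    IntegrableOn (fun t ↦ negLogTanhHalf t * log (2 * sinh t)) (Ioi 0) ∧
      ∫ t in Ioi (0 : ℝ), negLogTanhHalf t * log (2 * sinh t) = 0 := by
  obtain ⟨hA, hA'⟩ := integral_log_one_add_exp_neg_mul
  obtain ⟨hB, hB'⟩ := integral_negLogOneSubExp_sq
  have hC := integrableOn_mul_negLogOneSubExp
  have hD : IntegrableOn (fun t ↦ t * negLogOneSubExp t - negLogOneSubExp t ^ 2) (Ioi 0) :=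
    hC.sub hB
  have hcongr : EqOn (fun t ↦ log (1 + exp (-t)) * (t + log (1 + exp (-t))) +
      (t * negLogOneSubExp t - negLogOneSubExp t ^ 2))
      (fun t ↦ negLogTanhHalf t * log (2 * sinh t)) (Ioi 0) := fun t ht ↦ by
    simp only [negLogTanhHalf_eq ht, log_two_mul_sinh ht]
    ring
  refine ⟨(hA.add hD).congr_fun hcongr measurableSet_Ioi, ?_⟩
  rw [← setIntegral_congr_fun measurableSet_Ioi hcongr, integral_add hA hD,
    integral_sub hC hB, hA', hB']
  ring

lemma integral_div_sinh_mul_log_two_mul_sinh :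
    IntegrableOn (fun t ↦ t / sinh t * log (2 * sinh t)) (Ioi 0) ∧
      ∫ t in Ioi (0 : ℝ), t / sinh t * log (2 * sinh t) = π ^ 2 / 2 * log 2 := by
  obtain ⟨hZ, hZ'⟩ := integral_negLogTanhHalf_mul_log_two_mul_sinh
  have hs := integrableOn_negLogTanhHalf.const_mul (2 * log 2)
  have hg : IntegrableOn (fun t ↦ 2 * log 2 * negLogTanhHalf t -
      negLogTanhHalf t * log (2 * sinh t)) (Ioi 0) := hs.sub hZ
  obtain ⟨h1, h2⟩ := integral_comp_negLogTanhHalf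
    (fun t ↦ 2 * log 2 * negLogTanhHalf t - negLogTanhHalf t * log (2 * sinh t))
  have hcongr : EqOn (fun t ↦ 1 / sinh t * (2 * log 2 * negLogTanhHalf (negLogTanhHalf t) -
      negLogTanhHalf (negLogTanhHalf t) * log (2 * sinh (negLogTanhHalf t))))
      (fun t ↦ t / sinh t * log (2 * sinh t)) (Ioi 0) := fun t (ht : 0 < t) ↦ by
    have h3 := sinh_pos_iff.2 ht
    simp only [negLogTanhHalf_negLogTanhHalf ht, sinh_negLogTanhHalf ht, mul_one_div]
    rw [log_mul two_ne_zero h3.ne', log_div two_ne_zero h3.ne']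
    ring
  rw [setIntegral_congr_fun measurableSet_Ioi hcongr, integral_sub hs hZ, integral_const_mul,
    integral_negLogTanhHalf, hZ'] at h1
  rw [integrableOn_congr_fun hcongr measurableSet_Ioi] at h2
  exact ⟨h2.1 hg, by rw [← h1]; ring⟩

lemma integrableOn_mul_negLogTanhHalf_mul_coth :
    IntegrableOn (fun t ↦ t * negLogTanhHalf t * (cosh t / sinh t)) (Ioi 0) := by
  refine Integrable.mono' (integrableOn_mul_negLogTanhHalf.add integrableOn_negLogTanhHalf)
    (measurable_id.mul measurable_negLogTanhHalf |>.mul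
      (measurable_cosh.div measurable_sinh)).aestronglyMeasurable ?_
  filter_upwards [ae_restrict_mem measurableSet_Ioi] with t (ht : 0 < t)
  have h1 := negLogTanhHalf_pos ht
  have h2 := sinh_pos_iff.2 ht
  have h3 := cosh_pos t
  have h4 : t * cosh t ≤ (t + 1) * sinh t := by
    have h5 : cosh t = sinh t + exp (-t) := by rw [cosh_eq, sinh_eq]; ring
    have h6 : t * exp (-t) ≤ t * 1 := by gcongr; exact exp_le_one_iff.2 (by linarith)
    have h7 : t ≤ sinh t := self_le_sinh_iff.2 ht.le
    rw [h5]
    linarith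
  rw [norm_of_nonneg (by positivity), Pi.add_apply, ← mul_div_assoc, div_le_iff₀ h2]
  nlinarith

lemma tendsto_negLogTanhHalf_atTop : Tendsto negLogTanhHalf atTop (𝓝 0) := by
  refine squeeze_zero' ?_ ?_ tendsto_inv_atTop_zero
  · filter_upwards [eventually_gt_atTop 0] with t ht using (negLogTanhHalf_pos ht).le
  · filter_upwards [eventually_gt_atTop 0] with t ht
    refine (negLogTanhHalf_le ht).trans ?_
    rw [one_div]
    exact inv_anti₀ ht (self_le_sinh_iff.2 ht.le)

lemma tendsto_negLogTanhHalf_zero : Tendsto negLogTanhHalf (𝓝[>] 0) atTop := by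
  have h1 : Tendsto (fun t : ℝ ↦ tanh (t / 2)) (𝓝[>] 0) (𝓝[>] 0) := by
    refine tendsto_nhdsWithin_iff.2 ⟨?_, ?_⟩
    · have h2 : ContinuousAt (fun t : ℝ ↦ tanh (t / 2)) 0 := by
        simp only [tanh_eq_sinh_div_cosh]
        exact ContinuousAt.div (by fun_prop) (by fun_prop) (cosh_pos _).ne'
      simpa using h2.tendsto.mono_left nhdsWithin_le_nhds
    · filter_upwards [self_mem_nhdsWithin] with t (ht : 0 < t)
      exact tanh_pos_of_pos (by positivity)
  exact tendsto_neg_atBot_atTop.comp (tendsto_log_nhdsGT_zero.comp h1)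

lemma abs_log_two_mul_sinh_le {t : ℝ} (ht : 0 < t) :
    |log (2 * sinh t)| ≤ t + negLogTanhHalf t := by
  have h1 := sinh_pos_iff.2 ht
  have h2 := negLogTanhHalf_pos ht
  have key : ∀ u, 0 < u → log (2 * sinh u) ≤ u := fun u hu ↦ by
    have := sinh_pos_iff.2 hu
    rw [log_le_iff_le_exp (by positivity), sinh_eq]
    linarith [exp_pos (-u)]
  refine abs_le.2 ⟨?_, (key t ht).trans (by linarith)⟩
  have h3 := key _ h2
  rw [sinh_negLogTanhHalf ht, mul_one_div, log_div two_ne_zero h1.ne'] at h3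
  rw [log_mul two_ne_zero h1.ne']
  linarith [log_pos one_lt_two]

lemma abs_mul_negLogTanhHalf_mul_log_le {t : ℝ} (ht : 0 < t) :
    |t * negLogTanhHalf t * log (2 * sinh t)| ≤ 2 * (t * exp (-(1 / 2 * t))) +
      2 * (negLogTanhHalf t * exp (-(1 / 2 * negLogTanhHalf t))) := by
  have key : ∀ u, 0 < u → u ^ 2 * negLogTanhHalf u ≤ 2 * (u * exp (-(1 / 2 * u))) := fun u hu ↦ by
    refine le_trans ?_ (sq_div_sinh_le hu)
    rw [div_eq_mul_one_div]
    gcongr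
    exact negLogTanhHalf_le hu
  have h1 := negLogTanhHalf_pos ht
  have h2 := key t ht
  have h3 := key _ h1
  rw [negLogTanhHalf_negLogTanhHalf ht] at h3
  have h4 := mul_le_mul_of_nonneg_left (abs_log_two_mul_sinh_le ht) (mul_pos ht h1).le
  rw [abs_mul, abs_of_pos (mul_pos ht h1)]
  linarith

lemma integral_mul_negLogTanhHalf_mul_coth :
    ∫ t in Ioi (0 : ℝ), t * negLogTanhHalf t * (cosh t / sinh t) = π ^ 2 / 2 * log 2 := by
  obtain ⟨hA, hA'⟩ := integral_negLogTanhHalf_mul_log_two_mul_sinh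
  obtain ⟨hB, hB'⟩ := integral_div_sinh_mul_log_two_mul_sinh
  have hC := integrableOn_mul_negLogTanhHalf_mul_coth
  have hAB : IntegrableOn (fun t ↦ negLogTanhHalf t * log (2 * sinh t) -
      t / sinh t * log (2 * sinh t)) (Ioi 0) := hA.sub hB
  have hABC : IntegrableOn (fun t ↦ negLogTanhHalf t * log (2 * sinh t) -
      t / sinh t * log (2 * sinh t) + t * negLogTanhHalf t * (cosh t / sinh t)) (Ioi 0) :=
    hAB.add hC
  have hcont : Continuous fun t : ℝ ↦ 2 * (t * exp (-(1 / 2 * t))) := by fun_prop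
  have hnhds : Tendsto (fun t : ℝ ↦ 2 * (t * exp (-(1 / 2 * t)))) (𝓝 0) (𝓝 0) := by
    simpa using hcont.tendsto 0
  have htop : Tendsto (fun t : ℝ ↦ 2 * (t * exp (-(1 / 2 * t)))) atTop (𝓝 0) := by
    simpa using tendsto_mul_exp_neg_half_atTop.const_mul 2
  have hzero := (hnhds.mono_left nhdsWithin_le_nhds).add (htop.comp tendsto_negLogTanhHalf_zero)
  have h := integral_Ioi_eq_zero_of_hasDerivAt
    (F := fun t ↦ t * negLogTanhHalf t * log (2 * sinh t)) (by simp)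
    (fun t ht ↦ by
      have h1 := sinh_pos_iff.2 ht
      refine (((hasDerivAt_id t).mul (hasDerivAt_negLogTanhHalf ht)).mul
        (((hasDerivAt_sinh t).const_mul 2).log (by positivity))).congr_deriv ?_
      simp only [id, Pi.mul_apply]
      field_simp
      ring)
    hABC (fun t ↦ abs_mul_negLogTanhHalf_mul_log_le)
    (by simpa using hzero) (by simpa using htop.add (hnhds.comp tendsto_negLogTanhHalf_atTop))
  rw [integral_add hAB hC, integral_sub hA hB, hA', hB'] at h
  linarith

lemma tanh_negLogTanhHalf {t : ℝ} (ht : 0 < t) : tanh (negLogTanhHalf t) = 1 / cosh t := by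
  have h1 := sinh_pos_iff.2 ht
  rw [tanh_eq_sinh_div_cosh, sinh_negLogTanhHalf ht, cosh_negLogTanhHalf ht]
  field_simp

lemma integral_tanh_mul_negLogTanhHalf :
    ∫ t in Ioi (0 : ℝ), tanh t * negLogTanhHalf t = π ^ 2 / 8 := by
  have h := integral_comp_mul_left_Ioi (fun t ↦ t / sinh t) 0 two_pos
  rw [mul_zero, integral_div_sinh_Ioi, smul_eq_mul] at h
  rw [(integral_comp_negLogTanhHalf _).1, show π ^ 2 / 8 = 2⁻¹ * (π ^ 2 / 4) by ring, ← h]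
  refine setIntegral_congr_fun measurableSet_Ioi fun t (ht : 0 < t) ↦ ?_
  have h1 := sinh_pos_iff.2 ht
  simp only [negLogTanhHalf_negLogTanhHalf ht, tanh_negLogTanhHalf ht, sinh_two_mul]
  field_simp

lemma integral_mul_tanh_mul_negLogTanhHalf :
    ∫ t in Ioi (0 : ℝ), t * (tanh t * negLogTanhHalf t) = π ^ 2 / 4 * log 2 := by
  have hf : IntegrableOn (fun t ↦ t * (tanh t * negLogTanhHalf t)) (Ioi 0) := by
    refine Integrable.mono' integrableOn_mul_negLogTanhHalf ?_ ?_
    · simp only [tanh_eq_sinh_div_cosh]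
      exact (measurable_id.mul ((measurable_sinh.div measurable_cosh).mul
        measurable_negLogTanhHalf)).aestronglyMeasurable
    · filter_upwards [ae_restrict_mem measurableSet_Ioi] with t (ht : 0 < t)
      have h1 := tanh_pos_of_pos ht
      have h2 := negLogTanhHalf_pos ht
      rw [norm_of_nonneg (by positivity)]
      gcongr
      exact mul_le_of_le_one_left h2.le (tanh_lt_one t).le
  obtain ⟨h1, h2⟩ := integral_comp_negLogTanhHalf (fun t ↦ t * (tanh t * negLogTanhHalf t))
  have h3 := h2.1 hf
  have hsum := integral_add hf h3
  rw [← h1] at hsum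
  have hcongr : EqOn (fun t ↦ t * (tanh t * negLogTanhHalf t) + 1 / sinh t *
      (negLogTanhHalf t * (tanh (negLogTanhHalf t) * negLogTanhHalf (negLogTanhHalf t))))
      (fun t ↦ t * negLogTanhHalf t * (cosh t / sinh t)) (Ioi 0) := fun t (ht : 0 < t) ↦ by
    have h4 := sinh_pos_iff.2 ht
    have h5 := cosh_pos t
    have h6 := cosh_sq t
    simp only [negLogTanhHalf_negLogTanhHalf ht, tanh_negLogTanhHalf ht]
    rw [tanh_eq_sinh_div_cosh]
    field_simp
    rw [h6, mul_comm]
  rw [setIntegral_congr_fun measurableSet_Ioi hcongr, integral_mul_negLogTanhHalf_mul_coth] at hsum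
  linarith

/-- H(τ) = −(4/π²)·tanh(τ/2)·log(tanh(τ/4)) is a probability density on (0,∞),
    and a random variable with this density has expected value 4 log 2. -/
theorem translation_length_density :
    (∀ τ : ℝ, 0 < τ → 0 ≤ -(4 / π ^ 2) * Real.tanh (τ / 2) * Real.log (Real.tanh (τ / 4))) ∧
    (∫ τ in Ioi (0 : ℝ),
        -(4 / π ^ 2) * Real.tanh (τ / 2) * Real.log (Real.tanh (τ / 4))) = 1 ∧
    (∫ τ in Ioi (0 : ℝ),
        τ * (-(4 / π ^ 2) * Real.tanh (τ / 2) * Real.log (Real.tanh (τ / 4)))) =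
      4 * Real.log 2 := by
  have hlog (τ : ℝ) : log (tanh (τ / 4)) = -negLogTanhHalf (1 / 2 * τ) := by
    rw [negLogTanhHalf, neg_neg, show 1 / 2 * τ / 2 = τ / 4 by ring]
  have hhalf (τ : ℝ) : τ / 2 = 1 / 2 * τ := by ring
  refine ⟨fun τ hτ ↦ ?_, ?_, ?_⟩
  · have h1 := negLogTanhHalf_pos (show 0 < 1 / 2 * τ by positivity)
    have h2 := tanh_pos_of_pos (show 0 < τ / 2 by positivity)
    rw [hlog, neg_mul, neg_mul_neg]
    positivity
  · have h := integral_comp_mul_left_Ioi (fun t ↦ tanh t * negLogTanhHalf t) 0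
      (show (0 : ℝ) < 1 / 2 by norm_num)
    rw [mul_zero, integral_tanh_mul_negLogTanhHalf, smul_eq_mul] at h
    have h' (τ : ℝ) : -(4 / π ^ 2) * tanh (τ / 2) * log (tanh (τ / 4)) =
        4 / π ^ 2 * (tanh (1 / 2 * τ) * negLogTanhHalf (1 / 2 * τ)) := by
      rw [hlog, hhalf]
      ring
    simp only [h']
    rw [integral_const_mul, h]
    field_simp
    norm_num
  · have h := integral_comp_mul_left_Ioi (fun t ↦ t * (tanh t * negLogTanhHalf t)) 0
      (show (0 : ℝ) < 1 / 2 by norm_num)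
    rw [mul_zero, integral_mul_tanh_mul_negLogTanhHalf, smul_eq_mul] at h
    have h' (τ : ℝ) : τ * (-(4 / π ^ 2) * tanh (τ / 2) * log (tanh (τ / 4))) =
        8 / π ^ 2 * (1 / 2 * τ * (tanh (1 / 2 * τ) * negLogTanhHalf (1 / 2 * τ))) := by
      rw [hlog, hhalf]
      ring
    simp only [h']
    rw [integral_const_mul, h]
    field_simp
    norm_num
end
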